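/- arXiv:1709.09163 — 2 statements merged into one kernel-verified Lean document; each statement's English description precedes it below -/
import Mathlib

section
/- (Abelian Property) Fix a realization of the instruction stacks and an initial configuration η on ℤ/nℤ. If α and α' are two legal toppling sequences for η such that their odometer functions coincide, h_α = h_{α'}, then the resulting configurations coincide: Φ_α(η) = Φ_{α'}(η). -/
open MeasureTheory ProbabilityTheory

namespace ARW

/-- The state of a site: either a number of active particles (possibly zero),
or a single sleepy particle. -/
inductive SiteState where
  | active : ℕ → SiteState
  | sleepy : SiteState
  deriving DecidableEq

/-- A Diaconis–Fulton instruction: move an active particle to the left or right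
neighbour, try to put the particle at the site to sleep, or do nothing. -/
inductive Instr where
  | left : Instr
  | right : Instr
  | sleep : Instr
  | null : Instr
  deriving DecidableEq

instance : MeasurableSpace Instr := ⊤

/-- A site holds at least one active particle. -/
def SiteState.isActive : SiteState → Prop
  | .active k => 0 < k
  | .sleepy => False

/-- Total number of particles at a site. -/
def SiteState.particleCount : SiteState → ℕ
  | .active k => k
  | .sleepy => 1

/-- Number of active particles at a site. -/
def SiteState.activeCount : SiteState → ℕ
  | .active k => k
  | .sleepy => 0

/-- Add one active particle to a site; a sleepy particle is woken up. -/
def addParticle : SiteState → SiteState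
  | .active k => .active (k + 1)
  | .sleepy => .active 2

variable {V : Type} [AddGroup V] [One V] [DecidableEq V]

/-- Move one active particle from `x` to `y` (no effect if `x` has no active particle). -/
def moveFrom (x y : V) (η : V → SiteState) : V → SiteState :=
  match η x with
  | .active (k + 1) =>
      let η' := Function.update η x (.active k)
      Function.update η' y (addParticle (η' y))
  | _ => η

/-- Apply one instruction at site `x`. -/
def applyInstr (i : Instr) (x : V) (η : V → SiteState) : V → SiteState :=
  match i with
  | .left => moveFrom x (x - 1) η
  | .right => moveFrom x (x + 1) η
  | .sleep =>
      match η x with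
      | .active 1 => Function.update η x .sleepy
      | _ => η
  | .null => η

/-- One toppling at site `x`: use the first unused instruction from the stack at `x`
and record its use. The second component counts used instructions per site. -/
def toppleStep (I : V → ℕ → Instr) (s : (V → SiteState) × (V → ℕ)) (x : V) :
    (V → SiteState) × (V → ℕ) :=
  (applyInstr (I x (s.2 x)) x s.1, Function.update s.2 x (s.2 x + 1))

/-- A sequence of topplings is legal from a given state: every toppled site holds
an active particle at the moment it is toppled. -/
def LegalFrom (I : V → ℕ → Instr) : (V → SiteState) × (V → ℕ) → List V → Prop
  | _, [] => True
  | s, x :: rest => (s.1 x).isActive ∧ LegalFrom I (toppleStep I s x) rest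

/-- `α` is a legal toppling sequence for the initial configuration `η`. -/
def IsLegal (I : V → ℕ → Instr) (η : V → SiteState) (α : List V) : Prop :=
  LegalFrom I (η, fun _ => 0) α

/-- The configuration obtained from `η` by toppling the sequence `α`. -/
def Phi (I : V → ℕ → Instr) (α : List V) (η : V → SiteState) : V → SiteState :=
  (α.foldl (toppleStep I) (η, fun _ => 0)).1

/-- The odometer of a toppling sequence: the number of topplings at each site. -/
def odometer (α : List V) (x : V) : ℕ := α.count x

/-- A configuration is stable if no site holds an active particle. -/
def IsStable (η : V → SiteState) : Prop := ∀ x, ¬ (η x).isActive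

/-- `α` is a legal toppling sequence stabilizing `η`. -/
def Stabilizes (I : V → ℕ → Instr) (η : V → SiteState) (α : List V) : Prop :=
  IsLegal I η α ∧ IsStable (Phi I α η)

/-- `α` is a legal toppling sequence using only sites of `D` after which no site of `D`
holds an active particle (particles outside `D` are frozen). -/
def StabilizesIn (I : V → ℕ → Instr) (η : V → SiteState) (D : Set V) (α : List V) : Prop :=
  (∀ x ∈ α, x ∈ D) ∧ IsLegal I η α ∧ ∀ x ∈ D, ¬ ((Phi I α η) x).isActive


/-- The effect of an instruction on the site holding it, arrivals excluded. -/
def Instr.drain : Instr → SiteState → SiteState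
  | .left, .active (k + 1) => .active k
  | .right, .active (k + 1) => .active k
  | .sleep, .active 1 => .sleepy
  | _, s => s

/-- Add one active particle to the configuration at `w`. -/
def addAt {W : Type*} [DecidableEq W] (w : W) (η : W → SiteState) : W → SiteState :=
  Function.update η w (addParticle (η w))

/-- The effect of an instruction at `x` on the site receiving a particle, if any. -/
def Instr.deliver (i : Instr) (x : V) (η : V → SiteState) : V → SiteState :=
  match i with
  | .left => addAt (x - 1) η
  | .right => addAt (x + 1) η
  | _ => η

/-- Apply the effect of an instruction on the site `x` holding it, arrivals excluded. -/
def Instr.drainAt {W : Type*} [DecidableEq W] (i : Instr) (x : W) (η : W → SiteState) :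
    W → SiteState :=
  Function.update η x (i.drain (η x))

theorem SiteState.isActive.exists_eq_succ {s : SiteState} (h : s.isActive) :
    ∃ k, s = .active (k + 1) := by
  rcases s with (_ | k) | _
  · exact absurd h (Nat.lt_irrefl 0)
  · exact ⟨k, rfl⟩
  · exact h.elim

theorem isActive_addParticle (s : SiteState) : (addParticle s).isActive := by
  cases s <;> simp [addParticle, SiteState.isActive]

theorem Instr.drain_addParticle (i : Instr) {s : SiteState} (h : s.isActive) :
    i.drain (addParticle s) = addParticle (i.drain s) := by
  obtain ⟨k, rfl⟩ := h.exists_eq_succ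
  cases i <;> cases k <;> rfl

theorem applyInstr_eq_deliver_drainAt (i : Instr) (x : V) {η : V → SiteState}
    (h : (η x).isActive) : applyInstr i x η = i.deliver x (i.drainAt x η) := by
  obtain ⟨k, hk⟩ := h.exists_eq_succ
  cases i
  · simp [applyInstr, moveFrom, Instr.deliver, Instr.drainAt, addAt, hk, Instr.drain]
  · simp [applyInstr, moveFrom, Instr.deliver, Instr.drainAt, addAt, hk, Instr.drain]
  · cases k
    · simp [applyInstr, Instr.deliver, Instr.drainAt, hk, Instr.drain]
    · have hd : Instr.sleep.drain (η x) = η x := by simp [hk, Instr.drain]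
      simp only [applyInstr, Instr.deliver, Instr.drainAt, hd, Function.update_eq_self]
      rw [hk]
      rfl
  · simp [applyInstr, Instr.deliver, Instr.drainAt, Instr.drain]

theorem addAt_comm {W : Type*} [DecidableEq W] (v w : W) (η : W → SiteState) :
    addAt v (addAt w η) = addAt w (addAt v η) := by
  unfold addAt
  grind

theorem isActive_addAt {W : Type*} [DecidableEq W] (w : W) {x : W} {η : W → SiteState}
    (h : (η x).isActive) : (addAt w η x).isActive := by
  by_cases hx : x = w
  · subst hx
    simpa [addAt] using isActive_addParticle _
  · simpa [addAt, hx] using h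

theorem Instr.isActive_deliver (i : Instr) (y : V) {x : V} {η : V → SiteState}
    (h : (η x).isActive) : (i.deliver y η x).isActive := by
  cases i
  · exact isActive_addAt _ h
  · exact isActive_addAt _ h
  · exact h
  · exact h

theorem Instr.isActive_drainAt {W : Type*} [DecidableEq W] (i : Instr) {x y : W} (hxy : x ≠ y)
    {η : W → SiteState} (h : (η x).isActive) : (i.drainAt y η x).isActive := by
  simpa [Instr.drainAt, hxy] using h

theorem Instr.drainAt_addAt {W : Type*} [DecidableEq W] (i : Instr) (x w : W) {η : W → SiteState}
    (h : (η x).isActive) :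
    i.drainAt x (addAt w η) = addAt w (i.drainAt x η) := by
  have := i.drain_addParticle h
  unfold Instr.drainAt addAt
  grind

theorem Instr.drainAt_deliver (i j : Instr) (x y : V) {η : V → SiteState}
    (h : (η x).isActive) : i.drainAt x (j.deliver y η) = j.deliver y (i.drainAt x η) := by
  cases j
  · exact i.drainAt_addAt _ _ h
  · exact i.drainAt_addAt _ _ h
  · rfl
  · rfl

theorem Instr.deliver_comm (i j : Instr) (x y : V) (η : V → SiteState) :
    i.deliver x (j.deliver y η) = j.deliver y (i.deliver x η) := by
  cases i <;> cases j <;> first | rfl | exact addAt_comm _ _ _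

theorem Instr.drainAt_comm {W : Type*} [DecidableEq W] (i j : Instr) {x y : W} (hxy : x ≠ y)
    (η : W → SiteState) :
    i.drainAt x (j.drainAt y η) = j.drainAt y (i.drainAt x η) := by
  unfold Instr.drainAt
  grind

theorem isActive_applyInstr (j : Instr) {x y : V} (hxy : x ≠ y) {η : V → SiteState}
    (hx : (η x).isActive) (hy : (η y).isActive) : (applyInstr j y η x).isActive := by
  rw [applyInstr_eq_deliver_drainAt j y hy]
  exact j.isActive_deliver y (j.isActive_drainAt hxy hx)

theorem applyInstr_comm (i j : Instr) {x y : V} (hxy : x ≠ y) {η : V → SiteState}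
    (hx : (η x).isActive) (hy : (η y).isActive) :
    applyInstr i x (applyInstr j y η) = applyInstr j y (applyInstr i x η) := by
  rw [applyInstr_eq_deliver_drainAt i x (isActive_applyInstr j hxy hx hy),
    applyInstr_eq_deliver_drainAt j y (isActive_applyInstr i hxy.symm hy hx),
    applyInstr_eq_deliver_drainAt j y hy, applyInstr_eq_deliver_drainAt i x hx,
    i.drainAt_deliver j x y (j.isActive_drainAt hxy hx),
    j.drainAt_deliver i y x (i.isActive_drainAt hxy.symm hy),
    i.deliver_comm, i.drainAt_comm j hxy]

theorem isActive_toppleStep (I : V → ℕ → Instr) {s : (V → SiteState) × (V → ℕ)} {x y : V}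
    (hxy : x ≠ y) (hx : (s.1 x).isActive) (hy : (s.1 y).isActive) :
    ((toppleStep I s y).1 x).isActive :=
  isActive_applyInstr _ hxy hx hy

/-- Legal topplings at distinct sites commute. -/
theorem toppleStep_comm (I : V → ℕ → Instr) {s : (V → SiteState) × (V → ℕ)} {x y : V}
    (hxy : x ≠ y) (hx : (s.1 x).isActive) (hy : (s.1 y).isActive) :
    toppleStep I (toppleStep I s y) x = toppleStep I (toppleStep I s x) y := by
  simp only [toppleStep, Function.update_of_ne hxy, Function.update_of_ne hxy.symm]
  rw [applyInstr_comm _ _ hxy hx hy, Function.update_comm hxy]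

/-- If `x` can be toppled legally now, its first toppling in a legal sequence can be
brought to the front. -/
theorem LegalFrom.move_to_front (I : V → ℕ → Instr) {x : V} (β γ : List V)
    (s : (V → SiteState) × (V → ℕ)) (hxβ : x ∉ β) (hx : (s.1 x).isActive)
    (h : LegalFrom I s (β ++ x :: γ)) :
    LegalFrom I s (x :: (β ++ γ)) ∧
      (β ++ x :: γ).foldl (toppleStep I) s = (x :: (β ++ γ)).foldl (toppleStep I) s := by
  induction β generalizing s with
  | nil => exact ⟨h, rfl⟩
  | cons y β ih =>
    obtain ⟨hxy, hxβ⟩ := not_or.mp (mt List.mem_cons.mpr hxβ)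
    obtain ⟨hy, h⟩ := h
    obtain ⟨⟨-, hl⟩, hf⟩ := ih (toppleStep I s y) hxβ (isActive_toppleStep I hxy hx hy) h
    have hc := toppleStep_comm I hxy hx hy
    rw [hc] at hl
    refine ⟨⟨hx, isActive_toppleStep I (Ne.symm hxy) hy hx, hl⟩, ?_⟩
    simp only [List.cons_append, List.foldl_cons] at hf ⊢
    rw [hf, hc]

theorem LegalFrom.foldl_eq_of_perm (I : V → ℕ → Instr) {α α' : List V}
    (s : (V → SiteState) × (V → ℕ)) (h : LegalFrom I s α) (h' : LegalFrom I s α')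
    (hp : α.Perm α') : α.foldl (toppleStep I) s = α'.foldl (toppleStep I) s := by
  induction α generalizing s α' with
  | nil => rw [hp.nil_eq]
  | cons x α ih =>
    obtain ⟨β, γ, rfl, hxβ⟩ := List.eq_append_cons_of_mem (hp.subset List.mem_cons_self)
    obtain ⟨⟨-, hl⟩, hf⟩ := LegalFrom.move_to_front I β γ s hxβ h.1 h'
    rw [hf]
    exact ih _ h.2 hl (hp.trans List.perm_middle).cons_inv

/-- **Abelian Property (Lemma 2 of Rolla–Sidoravicius).**
For a fixed realization of the instruction stacks on `ℤ/nℤ` (each instruction being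
a left move, a right move, or a sleep instruction) and a fixed initial configuration,
any two legal toppling sequences with the same odometer function produce the same
final configuration. -/
theorem abelian_property (n : ℕ) (I : ZMod n → ℕ → Instr)
    (hI : ∀ (x : ZMod n) (j : ℕ), I x j ≠ Instr.null)
    (η : ZMod n → SiteState) (α α' : List (ZMod n))
    (hα : IsLegal I η α) (hα' : IsLegal I η α')
    (hodo : ∀ x : ZMod n, odometer α x = odometer α' x) :
    Phi I α η = Phi I α' η := by
  exact congrArg Prod.fst (LegalFrom.foldl_eq_of_perm I _ hα hα' (List.perm_iff_count.mpr hodo))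

end ARW
end

section
/- (Monotonicity under ignored sleep instructions) Let 𝓘 = {ξ_{(x,j)}} be an array of instructions and let 𝓘' = {ξ'_{(x,j)}} be another array such that for each (x,j) either ξ'_{(x,j)} = ξ_{(x,j)}, or ξ_{(x,j)} = τ_{x,ρ} and ξ'_{(x,j)} = 𝔫 (the null instruction, which leaves every configuration unchanged). Then for any initial configuration η, if α is a legal toppling sequence stabilizing η using instructions from 𝓘, and α' is a legal toppling sequence stabilizing η using instructions from 𝓘', then h_{α'}(x) ≥ h_α(x) for every site x ∈ ℤ/nℤ. -/
open MeasureTheory ProbabilityTheory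

namespace ARW

variable {V : Type} [AddGroup V] [One V] [DecidableEq V]

/-- The number of instructions equal to `i` among the first `m` instructions at `x`. -/
def instrCount (I : V → ℕ → Instr) (i : Instr) (x : V) (m : ℕ) : ℕ :=
  Nat.count (fun j => I x j = i) m

/-- The last event at `x` that could have changed whether the site sleeps was a sleep: either
the last of the `m` instructions used there, or the initial state if none was used. -/
def PutToSleep (I : V → ℕ → Instr) (η : V → SiteState) (x : V) : ℕ → Prop
  | 0 => η x = .sleepy
  | m + 1 => I x m = .sleep

/-- The description of a state reached by legal topplings in terms of its odometer alone:
particle numbers balance, and a site sleeps iff it holds exactly one particle and the last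
instruction used there was a sleep. -/
structure Consistent (I : V → ℕ → Instr) (η : V → SiteState)
    (s : (V → SiteState) × (V → ℕ)) : Prop where
  balance : ∀ z, (s.1 z).particleCount + instrCount I .left z (s.2 z)
      + instrCount I .right z (s.2 z)
    = (η z).particleCount + instrCount I .left (z + 1) (s.2 (z + 1))
      + instrCount I .right (z - 1) (s.2 (z - 1))
  putToSleep : ∀ z, s.1 z = .sleepy → PutToSleep I η z (s.2 z)
  sleepy_or : ∀ z, PutToSleep I η z (s.2 z) → s.1 z = .sleepy ∨ 2 ≤ (s.1 z).particleCount

theorem consistent_initial {V : Type} [AddGroup V] [One V]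
    (I : V → ℕ → Instr) (η : V → SiteState) :
    Consistent I η (η, fun _ => 0) where
  balance z := by simp [instrCount]
  putToSleep z h := h
  sleepy_or z h := Or.inl h

theorem instrCount_update {V : Type} [DecidableEq V]
    (I : V → ℕ → Instr) (i : Instr) (h : V → ℕ) (x z : V) :
    instrCount I i z (Function.update h x (h x + 1) z)
      = instrCount I i z (h z) + if z = x ∧ I x (h x) = i then 1 else 0 := by
  by_cases hz : z = x
  · subst hz
    simp [instrCount, Nat.count_succ]
  · simp [hz]

theorem putToSleep_update {V : Type} [DecidableEq V]
    (I : V → ℕ → Instr) (η : V → SiteState) (h : V → ℕ) (x z : V) :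
    PutToSleep I η z (Function.update h x (h x + 1) z)
      ↔ if z = x then I x (h x) = .sleep else PutToSleep I η z (h z) := by
  by_cases hz : z = x
  · subst hz
    simp [PutToSleep]
  · simp [hz]

theorem particleCount_addParticle (a : SiteState) :
    (addParticle a).particleCount = a.particleCount + 1 := by
  cases a <;> rfl

theorem addParticle_ne_sleepy (a : SiteState) : addParticle a ≠ .sleepy := by
  cases a <;> simp [addParticle]

theorem moveFrom_apply {V : Type} [DecidableEq V]
    {x y : V} {η : V → SiteState} {k : ℕ} (hx : η x = .active (k + 1)) (z : V) :
    moveFrom x y η z =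
      if z = y then addParticle (if z = x then .active k else η z)
      else if z = x then .active k else η z := by
  simp only [moveFrom, hx, Function.update_apply]
  by_cases hz : z = y
  · subst hz; simp
  · simp [hz]

theorem particleCount_moveFrom {V : Type} [DecidableEq V]
    {x y : V} {η : V → SiteState} {k : ℕ}
    (hx : η x = .active (k + 1)) (z : V) :
    (moveFrom x y η z).particleCount + (if z = x then 1 else 0)
      = (η z).particleCount + if z = y then 1 else 0 := by
  rw [moveFrom_apply hx]
  by_cases hzx : z = x
  · subst hzx
    have hpred : (SiteState.active k).particleCount + 1 = (η z).particleCount := by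
      rw [hx]; rfl
    split_ifs <;> simp_all [particleCount_addParticle]
  · split_ifs <;> simp [particleCount_addParticle]

theorem putToSleep_moveFrom {I : V → ℕ → Instr} {η : V → SiteState}
    {s : (V → SiteState) × (V → ℕ)} (hs : Consistent I η s) {x y : V} {k : ℕ}
    (hx : s.1 x = .active (k + 1)) (hi : I x (s.2 x) ≠ .sleep) (z : V) :
    (moveFrom x y s.1 z = .sleepy → PutToSleep I η z (Function.update s.2 x (s.2 x + 1) z)) ∧
    (PutToSleep I η z (Function.update s.2 x (s.2 x + 1) z) →
      moveFrom x y s.1 z = .sleepy ∨ 2 ≤ (moveFrom x y s.1 z).particleCount) := by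
  have h1 := hs.putToSleep z
  have h2 := hs.sleepy_or z
  rw [putToSleep_update, moveFrom_apply hx]
  by_cases hzx : z = x
  · simp only [hzx, if_true, hi, false_imp_iff, and_true]
    split_ifs <;> simp [addParticle_ne_sleepy]
  · simp only [hzx, if_false]
    split_ifs
    · refine ⟨fun h => absurd h (addParticle_ne_sleepy _), fun h => Or.inr ?_⟩
      rw [particleCount_addParticle]
      rcases h2 h with h' | h'
      · simp [h', SiteState.particleCount]
      · omega
    · exact ⟨h1, h2⟩

theorem Consistent.toppleStep {I : V → ℕ → Instr} {η : V → SiteState}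
    {s : (V → SiteState) × (V → ℕ)} (hs : Consistent I η s) {x : V}
    (hx : (s.1 x).isActive) : Consistent I η (toppleStep I s x) := by
  obtain ⟨k, hk⟩ : ∃ k, s.1 x = .active (k + 1) := by
    cases hsx : s.1 x with
    | active m =>
      rw [hsx] at hx
      exact ⟨m - 1, by rw [Nat.sub_add_cancel hx]⟩
    | sleepy => simp [hsx, SiteState.isActive] at hx
  cases hi : I x (s.2 x) with
  | left =>
    have hp := putToSleep_moveFrom (y := x - 1) hs hk (by simp [hi])
    refine ⟨fun z => ?_, fun z => ?_, fun z => ?_⟩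
    · have h1 := hs.balance z
      have h2 := particleCount_moveFrom (y := x - 1) hk z
      simp only [ARW.toppleStep, applyInstr, instrCount_update, hi]
      simp only [eq_sub_iff_add_eq] at h2
      simp
      omega
    · simpa only [ARW.toppleStep, applyInstr, hi] using (hp z).1
    · simpa only [ARW.toppleStep, applyInstr, hi] using (hp z).2
  | right =>
    have hp := putToSleep_moveFrom (y := x + 1) hs hk (by simp [hi])
    refine ⟨fun z => ?_, fun z => ?_, fun z => ?_⟩
    · have h1 := hs.balance z
      have h2 := particleCount_moveFrom (y := x + 1) hk z
      simp only [ARW.toppleStep, applyInstr, instrCount_update, hi]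
      simp only [← sub_eq_iff_eq_add] at h2
      simp
      omega
    · simpa only [ARW.toppleStep, applyInstr, hi] using (hp z).1
    · simpa only [ARW.toppleStep, applyInstr, hi] using (hp z).2
  | null =>
    refine ⟨fun z => ?_, fun z => ?_, fun z => ?_⟩
    · simpa [ARW.toppleStep, applyInstr, instrCount_update, hi] using hs.balance z
    · simp only [ARW.toppleStep, applyInstr, putToSleep_update, hi]
      split_ifs with hz
      · simp [hz, hk]
      · exact hs.putToSleep z
    · simp only [ARW.toppleStep, applyInstr, putToSleep_update, hi]
      split_ifs with hz
      · simp
      · exact hs.sleepy_or z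
  | sleep =>
    have happ : ∀ z, applyInstr .sleep x s.1 z =
        if z = x ∧ k = 0 then .sleepy else s.1 z := by
      intro z
      cases k with
      | zero => simp [applyInstr, hk, Function.update_apply]
      | succ k => simp [applyInstr, hk]
    refine ⟨fun z => ?_, fun z => ?_, fun z => ?_⟩
    · have h1 := hs.balance z
      simp only [ARW.toppleStep, instrCount_update, hi, happ]
      simp only [reduceCtorEq, and_false, if_false, add_zero]
      split_ifs with hz
      · obtain ⟨rfl, rfl⟩ := hz
        simpa only [hk, SiteState.particleCount, zero_add] using h1
      · exact h1
    · simp only [ARW.toppleStep, putToSleep_update, hi, happ]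
      by_cases hz : z = x
      · simp [hz]
      · simpa [hz] using hs.putToSleep z
    · simp only [ARW.toppleStep, putToSleep_update, hi, happ]
      by_cases hz : z = x
      · subst hz
        by_cases h0 : k = 0
        · simp [h0]
        · simp only [hk, h0, and_false, if_false, SiteState.particleCount]
          exact fun _ => Or.inr (by omega)
      · simpa [hz] using hs.sleepy_or z

theorem Consistent.foldl {I : V → ℕ → Instr} {η : V → SiteState} {α : List V}
    {s : (V → SiteState) × (V → ℕ)} (hs : Consistent I η s) (hα : LegalFrom I s α) :
    Consistent I η (α.foldl (ARW.toppleStep I) s) := by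
  induction α generalizing s with
  | nil => exact hs
  | cons x α ih => exact ih (hs.toppleStep hα.1) hα.2

theorem foldl_toppleStep_snd (I : V → ℕ → Instr) (α : List V)
    (s : (V → SiteState) × (V → ℕ)) (x : V) :
    (α.foldl (toppleStep I) s).2 x = s.2 x + odometer α x := by
  induction α generalizing s with
  | nil => rfl
  | cons y α ih =>
    rw [List.foldl_cons, ih]
    by_cases h : x = y
    · subst h
      simp [toppleStep, odometer]
      omega
    · simp [toppleStep, odometer, h, Ne.symm h]

/-- A site active under `I` cannot already have been toppled as often as in a consistent
state for `I'` with larger odometer in which that site is stable. -/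
theorem Consistent.lt_of_isActive {V : Type} [AddGroup V] [One V]
    {I I' : V → ℕ → Instr}
    (hII' : ∀ x j, I' x j = I x j ∨ (I x j = .sleep ∧ I' x j = .null))
    {η : V → SiteState} {s s' : (V → SiteState) × (V → ℕ)}
    (hs : Consistent I η s) (hs' : Consistent I' η s') (hle : s.2 ≤ s'.2) {x : V}
    (hx : (s.1 x).isActive) (hx' : ¬ (s'.1 x).isActive) : s.2 x < s'.2 x := by
  refine lt_of_le_of_ne (hle x) fun heq => ?_
  have hcount : ∀ i : Instr, i = .left ∨ i = .right → ∀ z m,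
      instrCount I' i z m = instrCount I i z m := by
    intro i hi z m
    unfold instrCount
    congr! 2 with j
    rcases hII' z j with h | ⟨h, h'⟩
    · rw [h]
    · rcases hi with rfl | rfl <;> simp [h, h']
  have hb := hs.balance x
  have hb' := hs'.balance x
  simp only [hcount .left (Or.inl rfl), hcount .right (Or.inr rfl), ← heq] at hb'
  have hl : instrCount I .left (x + 1) (s.2 (x + 1)) ≤ instrCount I .left (x + 1) (s'.2 (x + 1)) :=
    Nat.count_monotone _ (hle _)
  have hr : instrCount I .right (x - 1) (s.2 (x - 1))
      ≤ instrCount I .right (x - 1) (s'.2 (x - 1)) :=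
    Nat.count_monotone _ (hle _)
  cases hsx : s.1 x with
  | sleepy => simp [hsx, SiteState.isActive] at hx
  | active m =>
    simp only [hsx, SiteState.isActive] at hx
    simp only [hsx, SiteState.particleCount] at hb
    cases hsx' : s'.1 x with
    | active m' =>
      simp only [hsx', SiteState.isActive] at hx'
      simp only [hsx', SiteState.particleCount] at hb'
      omega
    | sleepy =>
      simp only [hsx', SiteState.particleCount] at hb'
      have hsleep' := hs'.putToSleep x hsx'
      rw [← heq] at hsleep'
      have hsleep : PutToSleep I η x (s.2 x) := by
        cases hm : s.2 x with
        | zero => simpa [hm, PutToSleep] using hsleep'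
        | succ j =>
          simp only [hm, PutToSleep] at hsleep' ⊢
          rcases hII' x j with h | h
          · rwa [← h]
          · exact h.1
      rcases hs.sleepy_or x hsleep with h | h
      · simp [hsx] at h
      · simp only [hsx, SiteState.particleCount] at h
        omega

/-- Least action principle: a legal sequence for `I` never topples more often than a consistent
stable state for `I'`. -/
theorem Consistent.foldl_snd_le {I I' : V → ℕ → Instr}
    (hII' : ∀ x j, I' x j = I x j ∨ (I x j = .sleep ∧ I' x j = .null))
    {η : V → SiteState} {α : List V} {s s' : (V → SiteState) × (V → ℕ)}
    (hs : Consistent I η s) (hs' : Consistent I' η s') (hstable : IsStable s'.1)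
    (hle : s.2 ≤ s'.2) (hα : LegalFrom I s α) :
    (α.foldl (ARW.toppleStep I) s).2 ≤ s'.2 := by
  induction α generalizing s with
  | nil => exact hle
  | cons x α ih =>
    refine ih (hs.toppleStep hα.1) (fun z => ?_) hα.2
    by_cases hz : z = x
    · subst hz
      simpa [ARW.toppleStep] using hs.lt_of_isActive hII' hs' hle hα.1 (hstable z)
    · simpa [ARW.toppleStep, hz] using hle z

/-- **Monotonicity under ignored sleep instructions (Lemma 5 of Rolla–Sidoravicius).**
Let `I` be an array of instructions on `ℤ/nℤ` and let `I'` be obtained from `I` by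
replacing some of the sleep instructions by the null instruction `𝔫` (which leaves
every configuration unchanged). If `α` is a legal toppling sequence stabilizing `η`
using the instructions `I`, and `α'` is a legal toppling sequence stabilizing `η`
using the instructions `I'`, then `h_{α'}(x) ≥ h_α(x)` at every site. -/
theorem odometer_monotone_ignored_sleeps (n : ℕ) (I I' : ZMod n → ℕ → Instr)
    (hI : ∀ (x : ZMod n) (j : ℕ), I x j ≠ Instr.null)
    (hII' : ∀ (x : ZMod n) (j : ℕ),
      I' x j = I x j ∨ (I x j = Instr.sleep ∧ I' x j = Instr.null))
    (η : ZMod n → SiteState) (α α' : List (ZMod n))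
    (hα : Stabilizes I η α) (hα' : Stabilizes I' η α') :
    ∀ x : ZMod n, odometer α x ≤ odometer α' x := by
  intro x
  have h := (consistent_initial I η).foldl_snd_le hII'
    ((consistent_initial I' η).foldl hα'.1) hα'.2 (fun z => Nat.zero_le _) hα.1 x
  simpa [foldl_toppleStep_snd] using h

end ARW
end
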